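/- arXiv:2305.09364 — 4 statements merged into one kernel-verified Lean document; each statement's English description precedes it below -/
import Mathlib

section
/- Lemma 1.1 (support of conditional expectations): Let (X, 𝒜₀, μ) be a measure space and m a sub-σ-algebra of 𝒜₀ such that the trimmed measure μ|_m is σ-finite. Let Φ : ℝ → ℝ be a Young function (convex, even, finite-valued, Φ(0) = 0, Φ ≥ 0, not identically zero on (0,∞)) that vanishes only at zero, i.e. Φ(x) = 0 ↔ x = 0. Let f : X → ℝ be a nonnegative measurable function such that f and Φ∘f are integrable. Then the sets {x : μ[f|m](x) ≠ 0} and {x : μ[Φ∘f|m](x) ≠ 0} are equal up to a μ-null set. -/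
open MeasureTheory

/-- If `f` vanishes wherever `g` does, then `μ[f|m]` vanishes wherever `μ[g|m]` does. -/
theorem condExp_zero_of_zero
    {X : Type*} {𝒜₀ : MeasurableSpace X} (μ : Measure X)
    (m : MeasurableSpace X) (hm : m ≤ 𝒜₀) [SigmaFinite (μ.trim hm)]
    (f g : X → ℝ) (hfnn : 0 ≤ f) (hgnn : 0 ≤ g)
    (hf : Integrable f μ) (hg : Integrable g μ) (hgf : ∀ x, g x = 0 → f x = 0) :
    ∀ᵐ x ∂μ, (μ[g|m]) x = 0 → (μ[f|m]) x = 0 := by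
  have hs : MeasurableSet[m] {x | (μ[g|m]) x = 0} :=
    (stronglyMeasurable_condExp (μ := μ) (f := g) (m := m)).measurable (measurableSet_singleton 0)
  set s := {x | (μ[g|m]) x = 0} with hsdef
  have hs' : MeasurableSet[𝒜₀] s := hm _ hs
  have h1 : ∫ x in s, g x ∂μ = 0 := by
    rw [← setIntegral_condExp hm hg hs]
    exact setIntegral_eq_zero_of_forall_eq_zero fun x hx => hx
  rw [setIntegral_eq_zero_iff_of_nonneg_ae (Filter.Eventually.of_forall hgnn)
    hg.integrableOn] at h1
  have h2 : ∫ x in s, (μ[f|m]) x ∂μ = 0 := by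
    rw [setIntegral_condExp hm hf hs]
    apply integral_eq_zero_of_ae
    filter_upwards [h1] with x hx using hgf x hx
  rw [setIntegral_eq_zero_iff_of_nonneg_ae
    (ae_restrict_of_ae (condExp_nonneg (Filter.Eventually.of_forall hfnn)))
    integrable_condExp.integrableOn] at h2
  exact (ae_restrict_iff' hs').1 h2

/-- Lemma 1.1: for a Young function `Φ` vanishing only at zero and a nonnegative
integrable `f` with `Φ ∘ f` integrable, the supports of `μ[f|m]` and `μ[Φ ∘ f|m]`
coincide up to a `μ`-null set. -/
theorem support_condExp_eq_support_condExp_comp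
    {X : Type*} [𝒜₀ : MeasurableSpace X] (μ : Measure X)
    (m : MeasurableSpace X) (hm : m ≤ 𝒜₀) [SigmaFinite (μ.trim hm)]
    (Φ : ℝ → ℝ) (hΦconv : ConvexOn ℝ Set.univ Φ) (hΦeven : ∀ x, Φ (-x) = Φ x)
    (hΦnn : ∀ x, 0 ≤ Φ x) (hΦzero : ∀ x, Φ x = 0 ↔ x = 0)
    (f : X → ℝ) (hfnn : 0 ≤ f) (hfmeas : Measurable[𝒜₀] f)
    (hf : Integrable f μ) (hΦf : Integrable (Φ ∘ f) μ) :
    {x | (μ[f|m]) x ≠ 0} =ᵐ[μ] {x | (μ[Φ ∘ f|m]) x ≠ 0} := by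
  have hg : (0 : X → ℝ) ≤ Φ ∘ f := fun x => hΦnn _
  have h1 := condExp_zero_of_zero μ m hm f (Φ ∘ f) hfnn hg hf hΦf
    (fun x hx => (hΦzero _).1 hx)
  have h2 := condExp_zero_of_zero μ m hm (Φ ∘ f) f hg hfnn hΦf hf
    (fun x hx => (hΦzero _).2 hx)
  filter_upwards [h1, h2] with x hx1 hx2
  exact propext (not_congr ⟨hx2, hx1⟩)
end

section
/- Proposition 2.4 (every WCT operator has ascent at most 2): Let (X, 𝒜₀, μ) be a measure space and m a sub-σ-algebra of 𝒜₀ such that the trimmed measure μ|_m is σ-finite. Let u, w : X → ℝ be measurable functions that are bounded μ-a.e., and define T g = w · μ[u·g | m]. Then for every integrable f : X → ℝ and every n ≥ 2, one has T^[2] f =ᵐ[μ] 0 if and only if T^[n] f =ᵐ[μ] 0. In particular the null spaces of T² and Tⁿ coincide for all n ≥ 2, so the ascent of T is at most 2. -/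
open MeasureTheory

/-- The weighted conditional type (WCT) operator `T g = w ⬝ μ[u ⬝ g | m]`. -/
noncomputable def WCT {X : Type*} {𝒜₀ : MeasurableSpace X} (μ : Measure X)
    (m : MeasurableSpace X) (u w : X → ℝ) (g : X → ℝ) : X → ℝ :=
  fun x => w x * (μ[fun y => u y * g y | m]) x

/-- A bounded, strictly positive, integrable `m`-measurable function. -/
lemma exists_rho {X : Type*} {𝒜₀ : MeasurableSpace X} (μ : Measure X)
    (m : MeasurableSpace X) (hm : m ≤ 𝒜₀) [SigmaFinite (μ.trim hm)] :
    ∃ ρ : X → ℝ, StronglyMeasurable[m] ρ ∧ (∀ x, 0 < ρ x) ∧ (∀ x, ρ x ≤ 1) ∧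
      Integrable ρ μ := by
  obtain ⟨g, hg0, hgm, hgi⟩ :=
    exists_pos_lintegral_lt_of_sigmaFinite (μ.trim hm) (ε := 1) one_ne_zero
  have hsm : StronglyMeasurable[m] (fun x => min (g x : ℝ) 1) :=
    (Measurable.min (hgm.coe_nnreal_real) measurable_const).stronglyMeasurable
  refine ⟨fun x => min (g x : ℝ) 1, hsm, ?_, ?_, ?_⟩
  · intro x
    exact lt_min (by exact_mod_cast hg0 x) one_pos
  · intro x
    exact min_le_right _ _
  · rw [lintegral_trim hm hgm.coe_nnreal_ennreal] at hgi
    have hg : Integrable (fun x => (g x : ℝ)) μ := by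
      refine ⟨((hgm.mono hm le_rfl).coe_nnreal_real).aestronglyMeasurable, ?_⟩
      rw [hasFiniteIntegral_iff_enorm]
      refine lt_of_le_of_lt (le_of_eq ?_) (hgi.trans ENNReal.one_lt_top)
      refine lintegral_congr fun x => ?_
      simp
    refine hg.mono (hsm.mono hm).aestronglyMeasurable (Filter.Eventually.of_forall fun x => ?_)
    rw [Real.norm_of_nonneg (le_min (by positivity) zero_le_one),
      Real.norm_of_nonneg (by positivity)]
    exact min_le_left _ _

/-- On integrable `m`-measurable functions, `h ↦ μ[v * h | m]` is multiplication
by a fixed function. -/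
lemma exists_phi {X : Type*} {𝒜₀ : MeasurableSpace X} (μ : Measure X)
    (m : MeasurableSpace X) (hm : m ≤ 𝒜₀) [SigmaFinite (μ.trim hm)]
    (v : X → ℝ) (hv : Measurable[𝒜₀] v) (C : ℝ) (hC : ∀ᵐ x ∂μ, ‖v x‖ ≤ C) :
    ∃ φ : X → ℝ, ∀ h : X → ℝ, StronglyMeasurable[m] h → Integrable h μ →
      μ[v * h | m] =ᵐ[μ] φ * h := by
  obtain ⟨ρ, hρm, hρ0, hρ1, hρi⟩ := exists_rho μ m hm
  refine ⟨fun x => (μ[v * ρ | m]) x / ρ x, fun h hhm hhi => ?_⟩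
  have i1 : Integrable (v * ρ) μ := hρi.bdd_mul hv.aestronglyMeasurable hC
  have i2 : Integrable (v * h) μ := hhi.bdd_mul hv.aestronglyMeasurable hC
  have i3 : Integrable (ρ * (v * h)) μ :=
    i2.bdd_mul (c := 1) (hρm.mono hm).aestronglyMeasurable
      (Filter.Eventually.of_forall fun x => by
        rw [Real.norm_of_nonneg (hρ0 x).le]; exact hρ1 x)
  have e : ρ * (v * h) = h * (v * ρ) := by ring
  have a := condExp_mul_of_stronglyMeasurable_left hρm i3 i2
  have b := condExp_mul_of_stronglyMeasurable_left hhm (e ▸ i3) i1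
  rw [e] at a
  filter_upwards [a, b] with x ha hb
  have := (hρ0 x).ne'
  simp only [Pi.mul_apply] at *
  rw [ha] at hb
  field_simp
  linarith

theorem wct_ascent_le_two
    {X : Type*} [𝒜₀ : MeasurableSpace X] (μ : Measure X)
    (m : MeasurableSpace X) (hm : m ≤ 𝒜₀) [SigmaFinite (μ.trim hm)]
    (u w : X → ℝ) (hu : Measurable[𝒜₀] u) (hw : Measurable[𝒜₀] w)
    (hubdd : ∃ Cu : ℝ, ∀ᵐ x ∂μ, |u x| ≤ Cu) (hwbdd : ∃ Cw : ℝ, ∀ᵐ x ∂μ, |w x| ≤ Cw)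
    (f : X → ℝ) (hf : Integrable f μ) (n : ℕ) (hn : 2 ≤ n) :
    (WCT μ m u w)^[2] f =ᵐ[μ] 0 ↔ (WCT μ m u w)^[n] f =ᵐ[μ] 0 := by
  obtain ⟨Cu, hCu⟩ := hubdd
  obtain ⟨Cw, hCw⟩ := hwbdd
  obtain ⟨φ, hφ⟩ := exists_phi μ m hm (u * w) (hu.mul hw) (Cu * Cw) (by
    filter_upwards [hCu, hCw] with x h1 h2
    simp only [Pi.mul_apply, norm_mul, Real.norm_eq_abs]
    exact mul_le_mul h1 h2 (abs_nonneg _) ((abs_nonneg _).trans h1))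
  have key : ∀ k : ℕ, ∃ g : X → ℝ, StronglyMeasurable[m] g ∧ Integrable g μ ∧
      (WCT μ m u w)^[k + 1] f = w * g ∧
      g =ᵐ[μ] fun x => φ x ^ k * (μ[fun y => u y * f y | m]) x := by
    intro k
    induction k with
    | zero =>
      refine ⟨μ[fun y => u y * f y | m], stronglyMeasurable_condExp, integrable_condExp,
        rfl, ?_⟩
      simp
    | succ k ih =>
      obtain ⟨g, hgm, hgi, hgT, hge⟩ := ih
      refine ⟨μ[u * w * g | m], stronglyMeasurable_condExp, integrable_condExp, ?_, ?_⟩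
      · rw [Function.iterate_succ_apply', hgT, mul_assoc]
        rfl
      · filter_upwards [hφ g hgm hgi, hge] with x h1 h2
        rw [h1, Pi.mul_apply, h2, pow_succ]
        ring
  obtain ⟨k, rfl⟩ : ∃ k, n = (k + 1) + 1 := ⟨n - 2, by omega⟩
  obtain ⟨g1, -, -, h1, e1⟩ := key 1
  obtain ⟨g2, -, -, h2, e2⟩ := key (k + 1)
  rw [h1, h2]
  apply Filter.eventually_congr
  filter_upwards [e1, e2] with x h1 h2
  simp [h1, h2]
end

section
/- Proposition 2.12, part 1 (the range of T² meets the null spaces trivially): Let (X, 𝒜₀, μ) be a measure space and m a sub-σ-algebra of 𝒜₀ such that the trimmed measure μ|_m is σ-finite. Let u, w : X → ℝ be measurable functions that are bounded μ-a.e., and define T g = w · μ[u·g | m]. Then for every integrable f : X → ℝ and every k ≥ 1, if T^[k](T^[2] f) =ᵐ[μ] 0 then T^[2] f =ᵐ[μ] 0. That is, R(T²) ∩ N(T^k) = {0} for every k ≥ 1. -/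
open MeasureTheory

theorem wct_swap {X : Type*} {𝒜₀ : MeasurableSpace X} (μ : Measure X)
    (m : MeasurableSpace X) (hm : m ≤ 𝒜₀) (v p q : X → ℝ) (hv : Measurable[𝒜₀] v)
    (C : ℝ) (hC : ∀ᵐ x ∂μ, |v x| ≤ C)
    (hp : StronglyMeasurable[m] p) (hq : StronglyMeasurable[m] q)
    (hpi : Integrable p μ) (hqi : Integrable q μ) :
    ∀ᵐ x ∂μ, p x * (μ[fun y => v y * q y | m]) x = q x * (μ[fun y => v y * p y | m]) x := by
  have hvp : Integrable (fun y => v y * p y) μ :=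
    hpi.bdd_mul hv.aestronglyMeasurable hC
  have hvq : Integrable (fun y => v y * q y) μ :=
    hqi.bdd_mul hv.aestronglyMeasurable hC
  have key : ∀ n : ℕ, ∀ᵐ x ∂μ, |p x| ≤ n →
      p x * (μ[fun y => v y * q y | m]) x = q x * (μ[fun y => v y * p y | m]) x := by
    intro n
    have hA : MeasurableSet[m] {x | |p x| ≤ (n : ℝ)} := by
      have h1 : StronglyMeasurable[m] (fun x => |p x|) := hp.norm
      exact h1.measurable measurableSet_Iic
    set A := {x | |p x| ≤ (n : ℝ)} with hAdef
    have hp' : StronglyMeasurable[m] (A.indicator p) := hp.indicator hA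
    have hb : ∀ x, ‖A.indicator p x‖ ≤ n := by
      intro x
      by_cases hx : x ∈ A
      · rw [Set.indicator_of_mem hx]; exact hx
      · rw [Set.indicator_of_notMem hx]; simp
    have hi1 : Integrable ((A.indicator p) * (fun y => v y * q y)) μ :=
      hvq.bdd_mul (hp'.mono hm).aestronglyMeasurable (Filter.Eventually.of_forall hb)
    have e1 := condExp_mul_of_stronglyMeasurable_left hp' hi1 hvq
    have heq : (A.indicator p) * (fun y => v y * q y)
        = q * (A.indicator (fun y => v y * p y)) := by
      funext x
      by_cases hx : x ∈ A
      · simp [hx]; ring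
      · simp [hx]
    have hi2 := hi1
    rw [heq] at hi2
    have e2 := condExp_mul_of_stronglyMeasurable_left hq hi2 (hvp.indicator (hm _ hA))
    have e3 := condExp_indicator (m := m) hvp hA
    rw [heq] at e1
    filter_upwards [e1, e2, e3] with x h1 h2 h3 hx
    have hx' : x ∈ A := hx
    rw [h1] at h2
    simp only [Pi.mul_apply] at h2
    rw [h3, Set.indicator_of_mem hx', Set.indicator_of_mem hx'] at h2
    exact h2
  filter_upwards [ae_all_iff.2 key] with x hx
  obtain ⟨n, hn⟩ := exists_nat_ge |p x|
  exact hx n hn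

theorem wct_integrable {X : Type*} {𝒜₀ : MeasurableSpace X} (μ : Measure X)
    (m : MeasurableSpace X) (u w : X → ℝ) (hw : Measurable[𝒜₀] w)
    (hwbdd : ∃ Cw : ℝ, ∀ᵐ x ∂μ, |w x| ≤ Cw) (f : X → ℝ) :
    Integrable (WCT μ m u w f) μ := by
  obtain ⟨C, hC⟩ := hwbdd
  exact integrable_condExp.bdd_mul hw.aestronglyMeasurable hC

theorem wct_step {X : Type*} {𝒜₀ : MeasurableSpace X} (μ : Measure X)
    (m : MeasurableSpace X) (hm : m ≤ 𝒜₀)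
    (u w : X → ℝ) (hu : Measurable[𝒜₀] u) (hw : Measurable[𝒜₀] w)
    (hubdd : ∃ Cu : ℝ, ∀ᵐ x ∂μ, |u x| ≤ Cu) (hwbdd : ∃ Cw : ℝ, ∀ᵐ x ∂μ, |w x| ≤ Cw)
    (f : X → ℝ) (h : WCT μ m u w (WCT μ m u w (WCT μ m u w f)) =ᵐ[μ] 0) :
    WCT μ m u w (WCT μ m u w f) =ᵐ[μ] 0 := by
  obtain ⟨Cu, hCu⟩ := hubdd
  obtain ⟨Cw, hCw⟩ := hwbdd
  have hv : Measurable[𝒜₀] (fun x => u x * w x) := hu.mul hw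
  have hC : ∀ᵐ x ∂μ, |u x * w x| ≤ Cu * Cw := by
    filter_upwards [hCu, hCw] with x h1 h2
    rw [abs_mul]
    exact mul_le_mul h1 h2 (abs_nonneg _) ((abs_nonneg _).trans h1)
  unfold WCT at h ⊢
  simp only [← mul_assoc] at h ⊢
  set a := μ[fun y => u y * f y | m] with ha
  set b := μ[fun y => u y * w y * a y | m] with hb
  set c := μ[fun y => u y * w y * b y | m] with hc
  have s1 := wct_swap μ m hm _ a b hv _ hC stronglyMeasurable_condExp
    stronglyMeasurable_condExp integrable_condExp integrable_condExp
  have s2 := wct_swap μ m hm _ b c hv _ hC stronglyMeasurable_condExp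
    stronglyMeasurable_condExp integrable_condExp integrable_condExp
  have z : μ[fun y => u y * w y * c y | m] =ᵐ[μ] 0 := by
    have : (fun y => u y * w y * c y) =ᵐ[μ] 0 := by
      filter_upwards [h] with x hx
      have hx' : w x * c x = 0 := hx
      simp [mul_assoc, hx']
    refine (condExp_congr_ae this).trans ?_
    rw [condExp_zero]
  filter_upwards [s1, s2, z] with x h1 h2 h3
  rw [h3] at h2
  have hc0 : c x = 0 := by
    have : c x * c x = 0 := by rw [← hc] at h2; simpa using h2.symm
    simpa using this
  have hb0 : b x = 0 := by
    have : b x * b x = 0 := by rw [← hb, ← hc, hc0] at h1; simpa using h1.symm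
    simpa using this
  simp [hb0]

/-- Proposition 2.12, part 1: `R(T²) ∩ N(T^k) = {0}` for every `k ≥ 1`:
if `T^k (T² f) = 0` a.e., then `T² f = 0` a.e. -/
theorem wct_range_sq_inter_ker
    {X : Type*} [𝒜₀ : MeasurableSpace X] (μ : Measure X)
    (m : MeasurableSpace X) (hm : m ≤ 𝒜₀) [SigmaFinite (μ.trim hm)]
    (u w : X → ℝ) (hu : Measurable[𝒜₀] u) (hw : Measurable[𝒜₀] w)
    (hubdd : ∃ Cu : ℝ, ∀ᵐ x ∂μ, |u x| ≤ Cu) (hwbdd : ∃ Cw : ℝ, ∀ᵐ x ∂μ, |w x| ≤ Cw)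
    (f : X → ℝ) (hf : Integrable f μ) (k : ℕ) (hk : 1 ≤ k)
    (h : (WCT μ m u w)^[k] ((WCT μ m u w)^[2] f) =ᵐ[μ] 0) :
    (WCT μ m u w)^[2] f =ᵐ[μ] 0 := by
  clear hk
  induction k with
  | zero => exact h
  | succ k ih =>
    apply ih
    have e : ∀ n, (WCT μ m u w)^[n] ((WCT μ m u w)^[2] f)
        = WCT μ m u w (WCT μ m u w ((WCT μ m u w)^[n] f)) := by
      intro n
      rw [← Function.iterate_add_apply, Nat.add_comm, Function.iterate_add_apply]
      rfl
    rw [e] at h ⊢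
    rw [Function.iterate_succ_apply'] at h
    exact wct_step μ m hm u w hu hw hubdd hwbdd _ h
end

section
/- Proposition 2.13 (the ascent of I − T is at most 1 for a power bounded WCT operator): Let (X, 𝒜₀, μ) be a measure space and m a sub-σ-algebra of 𝒜₀ such that the trimmed measure μ|_m is σ-finite. Let Φ : ℝ → ℝ be a Young function (convex, even, finite-valued, Φ(0) = 0, Φ ≥ 0) with Φ(x) > 0 for all x > 0 and Φ(x) → ∞ as x → ∞. Let u, w : X → ℝ be measurable functions that are bounded μ-a.e. with |μ[u·w | m](x)| ≤ 1 for μ-a.e. x, and define T g = w · μ[u·g | m]. Let f : X → ℝ be integrable with N_Φ(f) < ∞ and N_Φ(T f) < ∞, where N_Φ(g) = inf{k > 0 : ∫_X Φ(g/k) dμ ≤ 1} is the Luxemburg norm. If (I − T)² f =ᵐ[μ] 0, i.e. f − 2·T f + T^[2] f =ᵐ[μ] 0, then (I − T) f =ᵐ[μ] 0, i.e. T f =ᵐ[μ] f. Hence N((I−T)²) = N(I−T), so the ascent of I − T is at most 1. -/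
open MeasureTheory Filter
open scoped ENNReal

/-- The Luxemburg norm `N_Φ(f) = inf {k > 0 : ∫ Φ(f/k) dμ ≤ 1}`, with the convention
that the infimum of the empty set is `+∞`. -/
noncomputable def luxNorm {X : Type*} {mX : MeasurableSpace X} (μ : Measure X)
    (Φ : ℝ → ℝ) (f : X → ℝ) : ℝ≥0∞ :=
  ⨅ k ∈ {k : ℝ | 0 < k ∧ ∫ x, Φ (f x / k) ∂μ ≤ 1}, ENNReal.ofReal k

/-- Proposition 2.13: for a power bounded WCT operator `T` (ensured by `|E(uw)| ≤ 1`
a.e.), the ascent of `I - T` is at most 1: if `(I - T)² f = 0` a.e.,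
then `(I - T) f = 0` a.e. -/
theorem wct_ascent_id_sub_le_one
    {X : Type*} [𝒜₀ : MeasurableSpace X] (μ : Measure X)
    (m : MeasurableSpace X) (hm : m ≤ 𝒜₀) [SigmaFinite (μ.trim hm)]
    (Φ : ℝ → ℝ) (hΦconv : ConvexOn ℝ Set.univ Φ) (hΦeven : ∀ x, Φ (-x) = Φ x)
    (hΦ0 : Φ 0 = 0) (hΦnn : ∀ x, 0 ≤ Φ x) (hΦpos : ∀ x > 0, 0 < Φ x)
    (hΦtop : Tendsto Φ atTop atTop)
    (u w : X → ℝ) (hu : Measurable[𝒜₀] u) (hw : Measurable[𝒜₀] w)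
    (hubdd : ∃ Cu : ℝ, ∀ᵐ x ∂μ, |u x| ≤ Cu) (hwbdd : ∃ Cw : ℝ, ∀ᵐ x ∂μ, |w x| ≤ Cw)
    (hc : ∀ᵐ x ∂μ, |(μ[fun y => u y * w y | m]) x| ≤ 1)
    (f : X → ℝ) (hf : Integrable f μ)
    (hNf : luxNorm μ Φ f < ∞) (hNTf : luxNorm μ Φ (WCT μ m u w f) < ∞)
    (h : (fun x => f x - 2 * WCT μ m u w f x + (WCT μ m u w)^[2] f x) =ᵐ[μ] 0) :
    WCT μ m u w f =ᵐ[μ] f := by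
  obtain ⟨Cu, hCu⟩ := hubdd
  obtain ⟨Cw, hCw⟩ := hwbdd
  have hmulu : ∀ k : X → ℝ, Integrable k μ → Integrable (fun x => u x * k x) μ := fun k hk =>
    hk.bdd_mul hu.aestronglyMeasurable hCu
  have hmulw : ∀ k : X → ℝ, Integrable k μ → Integrable (fun x => w x * k x) μ := fun k hk =>
    hk.bdd_mul hw.aestronglyMeasurable hCw
  set g : X → ℝ := μ[fun y => u y * f y | m] with hg
  have hT1 : WCT μ m u w f = fun x => w x * g x := rfl
  set g2 : X → ℝ := μ[fun y => u y * (w y * g y) | m] with hg2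
  have hT2 : (WCT μ m u w)^[2] f = fun x => w x * g2 x := rfl
  set g3 : X → ℝ := μ[fun y => u y * (w y * g2 y) | m] with hg3
  have gi : Integrable g μ := integrable_condExp
  have g2i : Integrable g2 μ := integrable_condExp
  have gm : StronglyMeasurable[m] g := stronglyMeasurable_condExp
  have g2m : StronglyMeasurable[m] g2 := stronglyMeasurable_condExp
  have i1 := hmulu _ (hmulw _ gi)
  have i2 := hmulu _ (hmulw _ g2i)
  rw [hT1, hT2] at h
  rw [hT1]
  -- the relation after applying `E(u ·)`
  have hrel : g =ᵐ[μ] fun x => 2 * g2 x - g3 x := by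
    have e1 : (fun y => u y * f y) =ᵐ[μ]
        ((2 : ℝ) • (fun y => u y * (w y * g y))) - (fun y => u y * (w y * g2 y)) := by
      filter_upwards [h] with x hx
      simp only [Pi.zero_apply, Pi.sub_apply, Pi.smul_apply, smul_eq_mul] at hx ⊢
      linear_combination u x * hx
    have e2 := condExp_congr_ae (m := m) e1
    have e3 := condExp_sub (i1.smul (2 : ℝ)) i2 m
    have e4 := condExp_smul (μ := μ) (2 : ℝ) (fun y => u y * (w y * g y)) m
    filter_upwards [e2, e3, e4] with x h2 h3 h4
    rw [hg, h2, h3, Pi.sub_apply, h4]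
    rfl
  let r : X → ℝ := fun x => (1 + |g x| + |g2 x|)⁻¹
  have rpos : ∀ x, 0 < r x := fun x => by positivity
  have rm : StronglyMeasurable[m] r := by
    have h1 : Measurable[m] g := gm.measurable
    have h2 : Measurable[m] g2 := g2m.measurable
    have : Measurable[m] r := by
      refine Measurable.inv ?_
      exact (measurable_const.add h1.norm).add h2.norm
    exact this.stronglyMeasurable
  have bd : ∀ x, ‖(r * g) x‖ ≤ 1 ∧ ‖(r * g2) x‖ ≤ 1 := by
    intro x
    have hD : 0 < 1 + |g x| + |g2 x| := by positivity
    have a1 := abs_nonneg (g x)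
    have a2 := abs_nonneg (g2 x)
    simp only [Pi.mul_apply, norm_mul, Real.norm_eq_abs, abs_of_pos (rpos x)]
    simp only [r]
    constructor <;> rw [inv_mul_le_iff₀ hD] <;> linarith
  have pm := rm.mul gm
  have qm := rm.mul g2m
  have j1 : Integrable ((r * g2) * fun y => u y * (w y * g y)) μ :=
    i1.bdd_mul (qm.mono hm).aestronglyMeasurable (ae_of_all _ fun x => (bd x).2)
  have j2 : Integrable ((r * g) * fun y => u y * (w y * g2 y)) μ :=
    i2.bdd_mul (pm.mono hm).aestronglyMeasurable (ae_of_all _ fun x => (bd x).1)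
  have c1 := condExp_mul_of_stronglyMeasurable_left qm j1 i1
  have c2 := condExp_mul_of_stronglyMeasurable_left pm j2 i2
  have heq : ((r * g2) * fun y => u y * (w y * g y)) = (r * g) * fun y => u y * (w y * g2 y) := by
    funext x
    simp only [Pi.mul_apply]
    ring
  rw [heq] at c1
  filter_upwards [h, hrel, c1, c2] with x hx hr h1 h2
  rw [h1] at h2
  simp only [Pi.mul_apply, Pi.zero_apply] at h2 hx
  rw [← hg2, ← hg3] at h2
  have h3 : g2 x * g2 x = g x * g3 x := by
    apply mul_left_cancel₀ (rpos x).ne'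
    linear_combination h2
  have h4 : (g2 x - g x) ^ 2 = 0 := by
    linear_combination h3 + g x * hr
  have h5 : g2 x - g x = 0 := by simpa using h4
  linear_combination -hx + w x * h5
end
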